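/- Lemma 4.2: Let n ≥ 2 and l, k ≥ 1. Every isomorphism ι : B_l ⊗ B_k → B_k ⊗ B_l of U_q'(C_n^(1)) crystals satisfies ι((l,0,…,0) ⊗ (k,0,…,0)) = (k,0,…,0) ⊗ (l,0,…,0). -/

import Mathlib

namespace KTT

/-- Raw data of a crystal element `(x_1,…,x_n,x̄_n,…,x̄_1)`:
`b.1 i` is `x_{i+1}` and `b.2 i` is `x̄_{i+1}` for `i : Fin n`. -/
abbrev Tup (n : ℕ) := (Fin n → ℕ) × (Fin n → ℕ)

/-- The entry `x_j` (for `1 ≤ j ≤ n`). -/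
def xc {n : ℕ} (b : Tup n) (j : ℕ) : ℕ :=
  if h : j - 1 < n then b.1 ⟨j - 1, h⟩ else 0

/-- The entry `x̄_j` (for `1 ≤ j ≤ n`). -/
def xbc {n : ℕ} (b : Tup n) (j : ℕ) : ℕ :=
  if h : j - 1 < n then b.2 ⟨j - 1, h⟩ else 0

/-- Set the entry indexed by `j` (i.e. `x_j`) to the value `v`. -/
def setx {n : ℕ} (f : Fin n → ℕ) (j v : ℕ) : Fin n → ℕ :=
  fun t => if (t : ℕ) + 1 = j then v else f t

/-- `Σ_{i=1}^n (x_i + x̄_i)`. -/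
def tsum {n : ℕ} (b : Tup n) : ℕ := ∑ i, (b.1 i + b.2 i)

/-- The element `(v,0,…,0)`. -/
def uvec (n v : ℕ) : Tup n := (fun j => if (j : ℕ) = 0 then v else 0, fun _ => 0)

/-- The element `(0,v,---,0)` (only `x_2 = v` nonzero). -/
def u2vec (n v : ℕ) : Tup n := (fun j => if (j : ℕ) = 1 then v else 0, fun _ => 0)

/-- The element `(0,0,---,v)` (only `x̄_1 = v` nonzero). -/
def barvec (n v : ℕ) : Tup n := (fun _ => 0, fun j => if (j : ℕ) = 0 then v else 0)

/-- The element `(a,c,---,d)` with `x_1 = a`, `x_2 = c`, `x̄_1 = d`, all else `0`. -/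
def tripleVec (n a c d : ℕ) : Tup n :=
  (fun j => if (j : ℕ) = 0 then a else if (j : ℕ) = 1 then c else 0,
   fun j => if (j : ℕ) = 0 then d else 0)

/-! ### The `U_q'(C_n^{(1)})` crystal `B_l` -/

/-- Membership in the `C_n^{(1)}` crystal `B_l` : the sum of the entries belongs to
`{l, l-2, l-4, …}`. -/
def memC (n l : ℕ) (b : Tup n) : Prop := tsum b ≤ l ∧ (l - tsum b) % 2 = 0

def BC (n l : ℕ) : Set (Tup n) := {b | memC n l b}

/-- The number `x_0(b)` of `(0,0̄)` pairs. -/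
def x0 (l : ℕ) {n : ℕ} (b : Tup n) : ℕ := (l - tsum b) / 2

/-- The operator `ẽ_i` on `B_l` (C case); `none` plays the role of `0`. -/
def eC (n l i : ℕ) (b : Tup n) : Option (Tup n) :=
  if i = 0 then
    if 0 < n then
      if xbc b 1 + 2 ≤ xc b 1 then some (setx b.1 1 (xc b 1 - 2), b.2)
      else if xc b 1 = xbc b 1 + 1 then
        some (setx b.1 1 (xc b 1 - 1), setx b.2 1 (xbc b 1 + 1))
      else if tsum b + 2 ≤ l then some (b.1, setx b.2 1 (xbc b 1 + 2))
      else none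
    else none
  else if i = n then
    if 0 < xbc b n then some (setx b.1 n (xc b n + 1), setx b.2 n (xbc b n - 1))
    else none
  else if i < n then
    if xbc b (i + 1) < xc b (i + 1) then
      some (setx (setx b.1 i (xc b i + 1)) (i + 1) (xc b (i + 1) - 1), b.2)
    else if 0 < xbc b i then
      some (b.1, setx (setx b.2 (i + 1) (xbc b (i + 1) + 1)) i (xbc b i - 1))
    else none
  else none

/-- The operator `f̃_i` on `B_l` (C case). -/
def fC (n l i : ℕ) (b : Tup n) : Option (Tup n) :=
  if i = 0 then
    if 0 < n then
      if xbc b 1 ≤ xc b 1 then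
        if tsum b + 2 ≤ l then some (setx b.1 1 (xc b 1 + 2), b.2) else none
      else if xc b 1 + 1 = xbc b 1 then
        some (setx b.1 1 (xc b 1 + 1), setx b.2 1 (xbc b 1 - 1))
      else some (b.1, setx b.2 1 (xbc b 1 - 2))
    else none
  else if i = n then
    if 0 < xc b n then some (setx b.1 n (xc b n - 1), setx b.2 n (xbc b n + 1))
    else none
  else if i < n then
    if xbc b (i + 1) ≤ xc b (i + 1) then
      if 0 < xc b i then
        some (setx (setx b.1 i (xc b i - 1)) (i + 1) (xc b (i + 1) + 1), b.2)
      else none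
    else some (b.1, setx (setx b.2 (i + 1) (xbc b (i + 1) - 1)) i (xbc b i + 1))
  else none

def eCIter (n l i m : ℕ) (b : Tup n) : Option (Tup n) :=
  (fun o => Option.bind o (eC n l i))^[m] (some b)

def fCIter (n l i m : ℕ) (b : Tup n) : Option (Tup n) :=
  (fun o => Option.bind o (fC n l i))^[m] (some b)

/-- `ε_i(b) = max {m | ẽ_i^m b ≠ 0}` (C case). -/
noncomputable def epsC (n l i : ℕ) (b : Tup n) : ℕ :=
  sSup {m | eCIter n l i m b ≠ none}

/-- `φ_i(b) = max {m | f̃_i^m b ≠ 0}` (C case). -/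
noncomputable def phiC (n l i : ℕ) (b : Tup n) : ℕ :=
  sSup {m | fCIter n l i m b ≠ none}

/-- `ẽ_i` on the tensor product `B_l ⊗ B_k` (C case). -/
noncomputable def eTenC (n l k i : ℕ) (u : Tup n × Tup n) : Option (Tup n × Tup n) :=
  if epsC n k i u.2 ≤ phiC n l i u.1 then (eC n l i u.1).map (fun c => (c, u.2))
  else (eC n k i u.2).map (fun c => (u.1, c))

/-- `f̃_i` on the tensor product `B_l ⊗ B_k` (C case). -/
noncomputable def fTenC (n l k i : ℕ) (u : Tup n × Tup n) : Option (Tup n × Tup n) :=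
  if epsC n k i u.2 < phiC n l i u.1 then (fC n l i u.1).map (fun c => (c, u.2))
  else (fC n k i u.2).map (fun c => (u.1, c))

/-- `ι : B_l ⊗ B_k → B_k ⊗ B_l` is an isomorphism of `U_q'(C_n^{(1)})` crystals. -/
def IsIsoC (n l k : ℕ) (ι : Tup n × Tup n → Tup n × Tup n) : Prop :=
  Set.BijOn ι (BC n l ×ˢ BC n k) (BC n k ×ˢ BC n l) ∧
  ∀ u ∈ BC n l ×ˢ BC n k, ∀ i ≤ n,
    Option.map ι (eTenC n l k i u) = eTenC n k l i (ι u) ∧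
    Option.map ι (fTenC n l k i u) = fTenC n k l i (ι u)

/-- `H` is an energy function for the isomorphism `ι` (C case), normalized by
`H((l,0,…,0) ⊗ (0,k,---,0)) = 0`. -/
def IsEnergyC (n l k : ℕ) (ι : Tup n × Tup n → Tup n × Tup n)
    (H : Tup n × Tup n → ℤ) : Prop :=
  (∀ u ∈ BC n l ×ˢ BC n k, ∀ i ≤ n, ∀ v, eTenC n l k i u = some v →
      H v = H u +
        (if i = 0 then
          (if epsC n k 0 u.2 ≤ phiC n l 0 u.1 ∧ epsC n l 0 (ι u).2 ≤ phiC n k 0 (ι u).1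
           then 1
           else if phiC n l 0 u.1 < epsC n k 0 u.2 ∧ phiC n k 0 (ι u).1 < epsC n l 0 (ι u).2
           then -1 else 0)
         else 0)) ∧
  H (uvec n l, u2vec n k) = 0

/-! ### The `U_q'(A_{2n-1}^{(2)})` crystal `B_l` -/

def memA (n l : ℕ) (b : Tup n) : Prop := tsum b = l

def BA (n l : ℕ) : Set (Tup n) := {b | memA n l b}

/-- The operator `ẽ_i` (A case). -/
def eA (n i : ℕ) (b : Tup n) : Option (Tup n) :=
  if i = 0 then
    if 1 < n then
      if xbc b 2 < xc b 2 then some (setx b.1 2 (xc b 2 - 1), setx b.2 1 (xbc b 1 + 1))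
      else if 0 < xc b 1 then some (setx b.1 1 (xc b 1 - 1), setx b.2 2 (xbc b 2 + 1))
      else none
    else none
  else if i = n then
    if 0 < xbc b n then some (setx b.1 n (xc b n + 1), setx b.2 n (xbc b n - 1))
    else none
  else if i < n then
    if xbc b (i + 1) < xc b (i + 1) then
      some (setx (setx b.1 i (xc b i + 1)) (i + 1) (xc b (i + 1) - 1), b.2)
    else if 0 < xbc b i then
      some (b.1, setx (setx b.2 (i + 1) (xbc b (i + 1) + 1)) i (xbc b i - 1))
    else none
  else none

/-- The operator `f̃_i` (A case). -/
def fA (n i : ℕ) (b : Tup n) : Option (Tup n) :=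
  if i = 0 then
    if 1 < n then
      if xbc b 2 ≤ xc b 2 then
        if 0 < xbc b 1 then some (setx b.1 2 (xc b 2 + 1), setx b.2 1 (xbc b 1 - 1))
        else none
      else some (setx b.1 1 (xc b 1 + 1), setx b.2 2 (xbc b 2 - 1))
    else none
  else if i = n then
    if 0 < xc b n then some (setx b.1 n (xc b n - 1), setx b.2 n (xbc b n + 1))
    else none
  else if i < n then
    if xbc b (i + 1) ≤ xc b (i + 1) then
      if 0 < xc b i then
        some (setx (setx b.1 i (xc b i - 1)) (i + 1) (xc b (i + 1) + 1), b.2)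
      else none
    else some (b.1, setx (setx b.2 (i + 1) (xbc b (i + 1) - 1)) i (xbc b i + 1))
  else none

def eAIter (n i m : ℕ) (b : Tup n) : Option (Tup n) :=
  (fun o => Option.bind o (eA n i))^[m] (some b)

def fAIter (n i m : ℕ) (b : Tup n) : Option (Tup n) :=
  (fun o => Option.bind o (fA n i))^[m] (some b)

noncomputable def epsA (n i : ℕ) (b : Tup n) : ℕ :=
  sSup {m | eAIter n i m b ≠ none}

noncomputable def phiA (n i : ℕ) (b : Tup n) : ℕ :=
  sSup {m | fAIter n i m b ≠ none}

/-- `ẽ_i` on a tensor product (A case). -/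
noncomputable def eTenA (n i : ℕ) (u : Tup n × Tup n) : Option (Tup n × Tup n) :=
  if epsA n i u.2 ≤ phiA n i u.1 then (eA n i u.1).map (fun c => (c, u.2))
  else (eA n i u.2).map (fun c => (u.1, c))

/-- `f̃_i` on a tensor product (A case). -/
noncomputable def fTenA (n i : ℕ) (u : Tup n × Tup n) : Option (Tup n × Tup n) :=
  if epsA n i u.2 < phiA n i u.1 then (fA n i u.1).map (fun c => (c, u.2))
  else (fA n i u.2).map (fun c => (u.1, c))

/-- `ι : B_l ⊗ B_k → B_k ⊗ B_l` is an isomorphism of `U_q'(A_{2n-1}^{(2)})` crystals. -/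
def IsIsoA (n l k : ℕ) (ι : Tup n × Tup n → Tup n × Tup n) : Prop :=
  Set.BijOn ι (BA n l ×ˢ BA n k) (BA n k ×ˢ BA n l) ∧
  ∀ u ∈ BA n l ×ˢ BA n k, ∀ i ≤ n,
    Option.map ι (eTenA n i u) = eTenA n i (ι u) ∧
    Option.map ι (fTenA n i u) = fTenA n i (ι u)

/-- `H` is an energy function for `ι` (A case), normalized by
`H((l,0,…,0) ⊗ (0,0,---,k)) = 0`. -/
def IsEnergyA (n l k : ℕ) (ι : Tup n × Tup n → Tup n × Tup n)
    (H : Tup n × Tup n → ℤ) : Prop :=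
  (∀ u ∈ BA n l ×ˢ BA n k, ∀ i ≤ n, ∀ v, eTenA n i u = some v →
      H v = H u +
        (if i = 0 then
          (if epsA n 0 u.2 ≤ phiA n 0 u.1 ∧ epsA n 0 (ι u).2 ≤ phiA n 0 (ι u).1
           then 1
           else if phiA n 0 u.1 < epsA n 0 u.2 ∧ phiA n 0 (ι u).1 < epsA n 0 (ι u).2
           then -1 else 0)
         else 0)) ∧
  H (uvec n l, barvec n k) = 0

/-! ### Words, tableaux and column insertion

Letters are encoded as natural numbers: the unbarred letter `j` (for `0 ≤ j ≤ n`) is `j`,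
and the barred letter `j̄` is `2n+1-j`; the natural order of `ℕ` is the order
`0 < 1 < ⋯ < n < n̄ < ⋯ < 1̄ < 0̄`.  A (two-row) tableau is encoded as the list of its
columns (left to right), each column being the list of its entries (top to bottom). -/

/-- The barred partner `j̄` of an unbarred letter `j`. -/
def bar (n j : ℕ) : ℕ := 2 * n + 1 - j

/-- Column insertion of a letter into a tableau with at most two rows. -/
def insertLetter (n : ℕ) : ℕ → List (List ℕ) → List (List ℕ)
  | a, [] => [[a]]
  | a, [p] :: rest =>
      if a ≤ p then [a] :: insertLetter n p rest else [p, a] :: rest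
  | a, [p, q] :: rest =>
      if p ≠ 0 ∧ p ≤ n ∧ q = bar n p ∧ p ≤ a ∧ a ≤ q then
        -- the column is a pair `(x, x̄)` with `x ≠ 0` and `x ≤ a ≤ x̄`
        [p - 1, a] :: insertLetter n (bar n (p - 1)) rest
      else if n + 1 ≤ q ∧ bar n q < p ∧ p < q ∧ a = bar n q ∧ q ≠ n + 1 then
        -- the column is `(β, x̄)` with `x < β < x̄`, `a = x` and `x ≠ n`
        [a + 1, bar n (a + 1)] :: insertLetter n p rest
      else if a ≤ p then [a, q] :: insertLetter n p rest
      else if a ≤ q then [p, a] :: insertLetter n q rest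
      else [p, q, a] :: rest
  | a, C :: rest => (C ++ [a]) :: rest

/-- Column insertion of a word `u = u_1 ⋯ u_j` into a tableau: `u_j` first, `u_1` last. -/
def insertWord (n : ℕ) (u : List ℕ) (T : List (List ℕ)) : List (List ℕ) :=
  u.foldr (fun a T => insertLetter n a T) T

/-- One step of reverse insertion: letter `g` comes back (moving leftward) into a column;
returns the restored column together with the letter passed further left. -/
def revStep (n g : ℕ) (C : List ℕ) : List ℕ × ℕ :=
  match C with
  | [p] => ([g], p)
  | [p, q] =>
      if p ≠ 0 ∧ p ≤ n ∧ q = bar n p ∧ p ≤ g ∧ g ≤ q then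
        ([g, bar n (p - 1)], p - 1)
      else if p ≤ n ∧ g = bar n p ∧ p < q ∧ q < g ∧ p ≠ n then
        ([p + 1, bar n (p + 1)], q)
      else if q ≤ g then ([p, g], q)
      else ([g, q], p)
  | _ => (C, g)

/-- Reverse insertion of a letter through a list of columns, from right to left;
returns the new columns and the letter ejected from the leftmost column. -/
def revPass (n g : ℕ) : List (List ℕ) → List (List ℕ) × ℕ
  | [] => ([], g)
  | C :: rest =>
      let p := revPass n g rest
      let q := revStep n p.2 C
      (q.1 :: p.1, q.2)

/-- Reverse-bump the rightmost cell of the first row (the last column, a single box). -/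
def rbFirst (n : ℕ) (T : List (List ℕ)) : List (List ℕ) × ℕ :=
  match T.getLast? with
  | some [a] => revPass n a T.dropLast
  | _ => (T, 0)

/-- Number of columns of height (at least) two, i.e. the length of the second row. -/
def numTwoCols (T : List (List ℕ)) : ℕ :=
  (T.filter (fun C => decide (2 ≤ C.length))).length

/-- Reverse-bump the rightmost cell of the second row. -/
def rbSecond (n : ℕ) (T : List (List ℕ)) : List (List ℕ) × ℕ :=
  match (T.drop (numTwoCols T - 1)).head? with
  | some [a, b] =>
      let p := revPass n b (T.take (numTwoCols T - 1))
      (p.1 ++ [a] :: T.drop (numTwoCols T), p.2)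
  | _ => (T, 0)

/-- Iterate a reverse-bumping step, collecting the ejected letters in order of ejection. -/
def rbIter (step : List (List ℕ) → List (List ℕ) × ℕ) :
    ℕ → List (List ℕ) → List (List ℕ) × List ℕ
  | 0, T => (T, [])
  | c + 1, T =>
      let p := step T
      let q := rbIter step c p.1
      (q.1, p.2 :: q.2)

/-- A one-row word regarded as a tableau (list of one-box columns). -/
def rowCols (w : List ℕ) : List (List ℕ) := w.map (fun a => [a])

/-- The row word of a one-row tableau. -/
def colsWord (T : List (List ℕ)) : List ℕ := T.foldr (fun C acc => C ++ acc) []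

/-- The word `1^{x_1} ⋯ n^{x_n} n̄^{x̄_n} ⋯ 1̄^{x̄_1}`. -/
def coreWord (n : ℕ) (b : Tup n) : List ℕ :=
  ((List.finRange n).map (fun i => List.replicate (b.1 i) ((i : ℕ) + 1))).foldr (· ++ ·) []
  ++ ((List.finRange n).reverse.map
      (fun i => List.replicate (b.2 i) (bar n ((i : ℕ) + 1)))).foldr (· ++ ·) []

/-- The word `𝕋(b) = 0^{x_0} 1^{x_1} ⋯ 1̄^{x̄_1} 0̄^{x_0}` of an element of the
`C_n^{(1)}` crystal `B_l`. -/
def rowWordC (n l : ℕ) (b : Tup n) : List ℕ :=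
  List.replicate (x0 l b) 0 ++ coreWord n b ++ List.replicate (x0 l b) (bar n 0)

/-- The word `𝕋(b)` with `z` pairs `(0, 0̄)` removed. -/
def hatWordC (n l z : ℕ) (b : Tup n) : List ℕ :=
  List.replicate (x0 l b - z) 0 ++ coreWord n b ++ List.replicate (x0 l b - z) (bar n 0)

/-- The word `𝒯(b) = 1^{x_1} ⋯ 1̄^{x̄_1}` of an element of the `A_{2n-1}^{(2)}` crystal. -/
def rowWordA (n : ℕ) (b : Tup n) : List ℕ := coreWord n b


def cG {n : ℕ} (l : ℕ) (b : Tup n) : ℕ := (l - tsum b) + 2 * (xc b 1 - xbc b 1)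

theorem tsum_aux {n : ℕ} (hn : 0 < n) (b : Tup n) (v w : ℕ) :
    tsum ((setx b.1 1 v, setx b.2 1 w) : Tup n) + xc b 1 + xbc b 1 = tsum b + v + w := by
  obtain ⟨m, rfl⟩ : ∃ m, n = m + 1 := ⟨n - 1, by omega⟩
  simp [tsum, xc, xbc, setx, Fin.sum_univ_succ]
  omega

theorem setx_self {n : ℕ} (b : Tup n) : setx b.1 1 (xc b 1) = b.1 := by
  funext t
  unfold setx xc
  split_ifs with h h2
  · exact congrArg _ (Fin.ext (by simp; omega))
  · have := t.2; omega
  · rfl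

theorem setx_self2 {n : ℕ} (b : Tup n) : setx b.2 1 (xbc b 1) = b.2 := by
  funext t
  unfold setx xbc
  split_ifs with h h2
  · exact congrArg _ (Fin.ext (by simp; omega))
  · have := t.2; omega
  · rfl

theorem xc_setx {n : ℕ} (hn : 0 < n) (f g : Fin n → ℕ) (v : ℕ) :
    xc ((setx f 1 v, g) : Tup n) 1 = v := by
  simp [xc, setx, hn]

theorem xbc_setx {n : ℕ} (hn : 0 < n) (f g : Fin n → ℕ) (v : ℕ) :
    xbc ((f, setx g 1 v) : Tup n) 1 = v := by
  simp [xbc, setx, hn]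

theorem xx_le {n : ℕ} (b : Tup n) : xc b 1 + xbc b 1 ≤ tsum b := by
  rcases Nat.eq_zero_or_pos n with rfl | hn
  · simp [xc, xbc]
  · have := tsum_aux hn b 0 0
    omega

theorem step_set {n l : ℕ} (hn : 0 < n) (b : Tup n) (hb : b ∈ BC n l) (v w : ℕ)
    (h : (v + 2 = xc b 1 ∧ w = xbc b 1 ∧ xbc b 1 + 2 ≤ xc b 1) ∨
      (v + 1 = xc b 1 ∧ w = xbc b 1 + 1 ∧ xc b 1 = xbc b 1 + 1) ∨
      (v = xc b 1 ∧ w = xbc b 1 + 2 ∧ xc b 1 ≤ xbc b 1 ∧ tsum b + 2 ≤ l)) :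
    ((setx b.1 1 v, setx b.2 1 w) : Tup n) ∈ BC n l ∧
      cG l ((setx b.1 1 v, setx b.2 1 w) : Tup n) + 2 = cG l b := by
  have h1 := tsum_aux hn b v w
  have h2 := xx_le b
  obtain ⟨h3, h4⟩ := hb
  refine ⟨⟨by omega, by omega⟩, ?_⟩
  unfold cG
  rw [xc_setx hn, xbc_setx hn]
  omega

theorem eC_some {n l : ℕ} (b c : Tup n) (hb : b ∈ BC n l)
    (h : eC n l 0 b = some c) : c ∈ BC n l ∧ cG l c + 2 = cG l b := by
  unfold eC at h
  rw [if_pos rfl] at h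
  split_ifs at h with hn h1 h2 h3
  · have := step_set hn b hb (xc b 1 - 2) (xbc b 1) (by omega)
    rw [setx_self2] at this
    cases h; exact this
  · have := step_set hn b hb (xc b 1 - 1) (xbc b 1 + 1) (by omega)
    cases h; exact this
  · have := step_set hn b hb (xc b 1) (xbc b 1 + 2) (by omega)
    rw [setx_self] at this
    cases h; exact this

theorem eC_none {n l : ℕ} (hn : 0 < n) (b : Tup n) (hb : b ∈ BC n l)
    (h : eC n l 0 b = none) : cG l b = 0 := by
  obtain ⟨h3, h4⟩ := hb
  unfold eC at h
  rw [if_pos rfl, if_pos hn] at h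
  split_ifs at h with h1 h2 h3
  unfold cG
  omega

theorem bind_iter_none {α : Type*} (f : α → Option α) (m : ℕ) :
    (fun o => Option.bind o f)^[m] none = none := by
  induction m with
  | zero => rfl
  | succ m ih => rw [Function.iterate_succ_apply]; exact ih

theorem sSup_zero {α : Type*} (f : α → Option α) (b : α) (h : f b = none) :
    sSup {m | (fun o => Option.bind o f)^[m] (some b) ≠ none} = 0 := by
  have : {m | (fun o => Option.bind o f)^[m] (some b) ≠ none} = {0} := by
    ext m
    cases m with
    | zero => simp
    | succ m =>
      simp only [Set.mem_setOf_eq, Function.iterate_succ_apply, Option.bind_some, h,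
        bind_iter_none, Set.mem_singleton_iff]
      simp
  rw [this]; simp

theorem iter_bound {n l : ℕ} (m : ℕ) : ∀ b ∈ BC n l, eCIter n l 0 m b ≠ none →
    2 * m ≤ cG l b := by
  induction m with
  | zero => intros; omega
  | succ m ih =>
    intro b hb h
    unfold eCIter at h
    rw [Function.iterate_succ_apply, Option.bind_some] at h
    cases hc : eC n l 0 b with
    | none => rw [hc, bind_iter_none] at h; exact absurd rfl h
    | some c =>
      rw [hc] at h
      obtain ⟨h1, h2⟩ := eC_some b c hb hc
      have := ih c h1 h
      omega

theorem eps_pos {n l : ℕ} (b c : Tup n) (hb : b ∈ BC n l) (h : eC n l 0 b = some c) :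
    0 < epsC n l 0 b := by
  have : 1 ≤ sSup {m | eCIter n l 0 m b ≠ none} := by
    apply le_csSup
    · refine ⟨cG l b, fun m hm => ?_⟩
      have := iter_bound m b hb hm
      omega
    · simp [eCIter, h]
  exact this

def CanE (n l k : ℕ) : ℕ → Tup n × Tup n → Prop
  | 0, _ => True
  | m + 1, u => ∃ v, eTenC n l k 0 u = some v ∧ CanE n l k m v

theorem eTen_some {n l k : ℕ} (u v : Tup n × Tup n) (hu : u ∈ BC n l ×ˢ BC n k)
    (h : eTenC n l k 0 u = some v) :
    v ∈ BC n l ×ˢ BC n k ∧ cG l v.1 + cG k v.2 + 2 = cG l u.1 + cG k u.2 := by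
  obtain ⟨h1, h2⟩ := hu
  unfold eTenC at h
  split_ifs at h
  · obtain ⟨c, hc, rfl⟩ := Option.map_eq_some_iff.1 h
    obtain ⟨h3, h4⟩ := eC_some _ c h1 hc
    exact ⟨⟨h3, h2⟩, by simp only; omega⟩
  · obtain ⟨c, hc, rfl⟩ := Option.map_eq_some_iff.1 h
    obtain ⟨h3, h4⟩ := eC_some _ c h2 hc
    exact ⟨⟨h1, h3⟩, by simp only; omega⟩

theorem canE_bound {n l k : ℕ} (m : ℕ) : ∀ u ∈ BC n l ×ˢ BC n k, CanE n l k m u →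
    2 * m ≤ cG l u.1 + cG k u.2 := by
  induction m with
  | zero => intros; omega
  | succ m ih =>
    rintro u hu ⟨v, hv, h⟩
    obtain ⟨h1, h2⟩ := eTen_some u v hu hv
    have := ih v h1 h
    omega

theorem canE_iso {n l k : ℕ} {ι : Tup n × Tup n → Tup n × Tup n} (hι : IsIsoC n l k ι) (m : ℕ) :
    ∀ u ∈ BC n l ×ˢ BC n k, CanE n l k m u → CanE n k l m (ι u) := by
  induction m with
  | zero => intros; trivial
  | succ m ih =>
    rintro u hu ⟨v, hv, h⟩
    refine ⟨ι v, ?_, ih v (eTen_some u v hu hv).1 h⟩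
    rw [← (hι.2 u hu 0 (Nat.zero_le _)).1, hv]; rfl

theorem canE_left {n l k : ℕ} (hn : 0 < n) (b2 : Tup n) (h2 : eC n k 0 b2 = none) (m : ℕ) :
    ∀ b1 ∈ BC n l, 2 * m ≤ cG l b1 → CanE n l k m (b1, b2) := by
  induction m with
  | zero => intros; trivial
  | succ m ih =>
    intro b1 hb h
    cases hc : eC n l 0 b1 with
    | none => have := eC_none hn b1 hb hc; omega
    | some c =>
      obtain ⟨h3, h4⟩ := eC_some b1 c hb hc
      refine ⟨(c, b2), ?_, ih c h3 (by omega)⟩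
      have : epsC n k 0 b2 = 0 := sSup_zero _ _ h2
      simp [eTenC, this, hc]

theorem canE_right {n l k : ℕ} (hn : 0 < n) (b1 : Tup n) (hb1 : b1 ∈ BC n l)
    (h1 : fC n l 0 b1 = none) (m : ℕ) :
    ∀ b2 ∈ BC n k, 2 * m ≤ cG l b1 + cG k b2 → CanE n l k m (b1, b2) := by
  induction m with
  | zero => intros; trivial
  | succ m ih =>
    intro b2 hb h
    cases hc : eC n k 0 b2 with
    | none =>
      apply canE_left hn b2 hc _ b1 hb1
      have := eC_none hn b2 hb hc
      omega
    | some c =>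
      obtain ⟨h3, h4⟩ := eC_some b2 c hb hc
      refine ⟨(b1, c), ?_, ih c h3 (by omega)⟩
      have h5 : phiC n l 0 b1 = 0 := sSup_zero _ _ h1
      have h6 := eps_pos b2 c hb hc
      simp [eTenC, h5, hc, h6.ne']

theorem tsum_uvec {n : ℕ} (hn : 0 < n) (l : ℕ) : tsum (uvec n l) = l := by
  obtain ⟨m, rfl⟩ : ∃ m, n = m + 1 := ⟨n - 1, by omega⟩
  simp [tsum, uvec, Fin.sum_univ_succ]

theorem xc_uvec {n : ℕ} (hn : 0 < n) (l : ℕ) : xc (uvec n l) 1 = l := by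
  simp [xc, uvec, hn]

theorem xbc_uvec {n : ℕ} (l : ℕ) : xbc (uvec n l) 1 = 0 := by
  simp [xbc, uvec]

theorem uvec_mem {n : ℕ} (hn : 0 < n) (l : ℕ) : uvec n l ∈ BC n l := by
  have := tsum_uvec hn l
  exact ⟨by omega, by omega⟩

theorem cG_uvec {n : ℕ} (hn : 0 < n) (l : ℕ) : cG l (uvec n l) = 2 * l := by
  simp [cG, tsum_uvec hn, xc_uvec hn, xbc_uvec]

theorem cG_le {n l : ℕ} (b : Tup n) (hb : b ∈ BC n l) : cG l b ≤ 2 * l := by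
  have h1 := xx_le b
  obtain ⟨h3, h4⟩ := hb
  unfold cG; omega

theorem cG_eq {n l : ℕ} (hn : 0 < n) (b : Tup n) (hb : b ∈ BC n l) (h : 2 * l ≤ cG l b) :
    b = uvec n l := by
  have h1 := xx_le b
  obtain ⟨h3, h4⟩ := hb
  unfold cG at h
  have h5 : xc b 1 = l := by omega
  have h6 : xbc b 1 = 0 := by omega
  have h7 := tsum_aux hn b 0 0
  have h8 : tsum ((setx b.1 1 0, setx b.2 1 0) : Tup n) = 0 := by omega
  have h9 : ∀ i, setx b.1 1 0 i + setx b.2 1 0 i = 0 := fun i =>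
    Finset.sum_eq_zero_iff.1 h8 i (Finset.mem_univ i)
  have e1 : b.1 = (uvec n l).1 := by
    funext i
    have h10 := h9 i
    simp only [setx] at h10
    simp only [uvec]
    simp only [xc, Nat.sub_self, hn, dite_true] at h5
    split_ifs with hi
    · rw [← h5]; exact congrArg _ (Fin.ext hi)
    · rw [if_neg (by omega)] at h10; omega
  have e2 : b.2 = (uvec n l).2 := by
    funext i
    have h10 := h9 i
    simp only [setx] at h10
    simp only [uvec]
    simp only [xbc, Nat.sub_self, hn, dite_true] at h6
    by_cases hi : (i : ℕ) = 0
    · rw [← h6]; exact congrArg _ (Fin.ext hi)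
    · rw [if_neg (by omega), if_neg (by omega)] at h10; omega
  exact Prod.ext e1 e2

/-- **Lemma 4.2.**  Every isomorphism `ι : B_l ⊗ B_k → B_k ⊗ B_l` of `U_q'(C_n^{(1)})`
crystals maps `(l,0,…,0) ⊗ (k,0,…,0)` to `(k,0,…,0) ⊗ (l,0,…,0)`. -/
theorem lemma_4_2
    (n l k : ℕ) (hn : 2 ≤ n) (hl : 1 ≤ l) (hk : 1 ≤ k)
    (ι : Tup n × Tup n → Tup n × Tup n) (hι : IsIsoC n l k ι) :
    ι (uvec n l, uvec n k) = (uvec n k, uvec n l) := by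
  have hn0 : 0 < n := by omega
  have hu : (uvec n l, uvec n k) ∈ BC n l ×ˢ BC n k := ⟨uvec_mem hn0 l, uvec_mem hn0 k⟩
  have hf : fC n l 0 (uvec n l) = none := by
    simp [fC, tsum_uvec hn0, xc_uvec hn0, xbc_uvec]
  have h1 : CanE n l k (l + k) (uvec n l, uvec n k) := by
    apply canE_right hn0 _ (uvec_mem hn0 l) hf _ _ (uvec_mem hn0 k)
    rw [cG_uvec hn0, cG_uvec hn0]; omega
  have h2 := canE_iso hι _ _ hu h1
  have hm := hι.1.mapsTo hu
  have h3 := canE_bound _ _ hm h2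
  obtain ⟨m1, m2⟩ := hm
  have h4 := cG_le _ m1
  have h5 := cG_le _ m2
  exact Prod.ext (cG_eq hn0 _ m1 (by omega)) (cG_eq hn0 _ m2 (by omega))
end KTT
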